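/- arXiv:1603.07167 — 4 statements merged into one kernel-verified Lean document; each statement's English description precedes it below -/
import Mathlib

section
/- Let E be a locally compact Polish space and Q a transition function satisfying the standing hypotheses (H). Then for every bounded measurable F : E → ℝ, every s ≥ 0 and x ∈ E one has, for all t ≥ s, ∫_E q(r,y)P(s,x;r,dy) ≤ a(T)V(x)e^{∫_s^r c(τ)dτ} for s ≤ r ≤ t ≤ T, and the forward integral identity U(s,t)F(x) = F(x) + ∫_s^t ( ∫_E L(r)F(y) P(s,x;r,dy) ) dr holds; in particular [s,∞) ∋ t ↦ U(s,t)F(x) is absolutely continuous and satisfies (∂/∂t) U(s,t)F(x) = U(s,t)L(t)F(x) for almost all t ≥ s (forward Kolmogorov equation). -/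
open MeasureTheory Set

variable {E : Type*}

/-- The cumulative intensity `q(t,x) = Q(t,x,E)`. -/
noncomputable def qIntensity [MeasurableSpace E] (Q : ℝ → E → Measure E) (t : ℝ) (x : E) : ℝ :=
  (Q t x univ).toReal

/-- The iterated kernels `P⁽ⁿ⁾(s,x;t,·)`. -/
noncomputable def Piter [MeasurableSpace E] (Q : ℝ → E → Measure E) :
    ℕ → ℝ → ℝ → E → Measure E
  | 0, s, t, x =>
      ENNReal.ofReal (Real.exp (-∫ r in s..t, qIntensity Q r x)) • Measure.dirac x
  | n + 1, s, t, x =>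
      Measure.bind
        ((volume.restrict (Ioc s t)).withDensity fun r =>
          ENNReal.ofReal (Real.exp (-∫ τ in s..r, qIntensity Q τ x)))
        fun r => Measure.bind (Q r x) fun y => Piter Q n r t y

/-- The minimal transition function `P(s,x;t,·) = Σ_n P⁽ⁿ⁾(s,x;t,·)`. -/
noncomputable def Pmin [MeasurableSpace E] (Q : ℝ → E → Measure E) (s t : ℝ) (x : E) :
    Measure E :=
  Measure.sum fun n => Piter Q n s t x

/-- The evolution system `U(s,t)F(x) = ∫_E F(y) P(s,x;t,dy)`. -/
noncomputable def Umin [MeasurableSpace E] (Q : ℝ → E → Measure E) (s t : ℝ) (F : E → ℝ)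
    (x : E) : ℝ :=
  ∫ y, F y ∂(Pmin Q s t x)

/-- `Q` is a transition function. -/
def IsTransitionFunction [MeasurableSpace E] [TopologicalSpace E]
    (Q : ℝ → E → Measure E) : Prop :=
  (∀ t x, 0 ≤ t → IsFiniteMeasure (Q t x)) ∧
  (∀ t x, 0 ≤ t → Q t x {x} = 0) ∧
  (∀ A : Set E, MeasurableSet A → Measurable fun p : ℝ × E => Q p.1 p.2 A) ∧
  (∀ T > (0 : ℝ), ∀ B : Set E, IsCompact B →
    ∃ C : ℝ, ∀ t ∈ Icc (0 : ℝ) T, ∀ x ∈ B, (Q t x univ).toReal ≤ C)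

/-- The standing hypotheses (H). -/
structure StandingHypotheses [MeasurableSpace E] [TopologicalSpace E]
    (Q : ℝ → E → Measure E) (V : E → ℝ) (c : ℝ → ℝ) : Prop where
  V_cont : Continuous V
  V_nonneg : ∀ x, 0 ≤ V x
  c_cont : Continuous c
  c_nonneg : ∀ t, 0 ≤ c t
  weak_cont : ∀ F : E → ℝ, Continuous F → (∃ M : ℝ, ∀ x, |F x| ≤ M * (1 + V x)) →
    ContinuousOn (fun p : ℝ × E => ∫ y, F y ∂(Q p.1 p.2)) {p : ℝ × E | 0 ≤ p.1}
  q_bound : ∀ T > (0 : ℝ), ∃ a > (0 : ℝ), ∀ t ∈ Icc (0 : ℝ) T, ∀ x,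
    qIntensity Q t x ≤ a * V x
  lyapunov : ∀ t : ℝ, 0 ≤ t → ∀ x,
    ∫⁻ y, ENNReal.ofReal (V y) ∂(Q t x)
      ≤ ENNReal.ofReal (c t * V x + qIntensity Q t x * V x)
  localization : ∀ ε > (0 : ℝ), ∀ B : Set E, IsCompact B → ∀ T > (0 : ℝ),
    ∃ A : Set E, IsCompact A ∧ ∀ x ∈ B, ∫ r in (0 : ℝ)..T, (Q r x Aᶜ).toReal < ε

/-- The (formal) generator `L(t)G(x) = ∫_E (G(y) − G(x)) Q(t,x,dy)`. -/
noncomputable def Lgen [MeasurableSpace E] (Q : ℝ → E → Measure E) (t : ℝ)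
    (G : E → ℝ) (x : E) : ℝ :=
  ∫ y, (G y - G x) ∂(Q t x)

open scoped ENNReal

/-- Lower integrals against a measurable family of finite measures depend measurably on the
parameter. -/
theorem measurable_lintegral_of_forall_isFiniteMeasure {α β : Type*} [MeasurableSpace α]
    [MeasurableSpace β] {m : α → Measure β} (hm : Measurable m)
    (hfin : ∀ a, IsFiniteMeasure (m a)) {f : α × β → ℝ≥0∞} (hf : Measurable f) :
    Measurable fun a => ∫⁻ b, f (a, b) ∂(m a) := by
  have hmass : Measurable fun a => m a univ := (Measure.measurable_coe MeasurableSet.univ).comp hm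
  have hmass' : Measurable fun a => 1 + m a univ := measurable_const.add hmass
  have hne (a : α) : 1 + m a univ ≠ 0 := by simp
  have hnt (a : α) : 1 + m a univ ≠ ∞ := by simp
  let κ : ProbabilityTheory.Kernel α β :=
    { toFun := fun a => (1 + m a univ)⁻¹ • m a
      measurable' := by
        refine Measure.measurable_of_measurable_coe _ fun A hA => ?_
        simp only [Measure.smul_apply, smul_eq_mul]
        exact hmass'.inv.mul ((Measure.measurable_coe hA).comp hm) }
  have hκ : ProbabilityTheory.IsFiniteKernel κ := by
    refine ⟨1, ENNReal.one_lt_top, fun a => ?_⟩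
    change (1 + m a univ)⁻¹ * m a univ ≤ 1
    rw [mul_comm, ← div_eq_mul_inv]
    exact ENNReal.div_le_of_le_mul (by simp)
  have hmeas : Measurable fun a => (1 + m a univ) * ∫⁻ b, f (a, b) ∂(κ a) :=
    hmass'.mul (hf.lintegral_kernel_prod_right' (κ := κ))
  convert hmeas using 2 with a
  change _ = _ * ∫⁻ b, f (a, b) ∂((1 + m a univ)⁻¹ • m a)
  rw [lintegral_smul_measure, smul_eq_mul, ← mul_assoc, ENNReal.mul_inv_cancel (hne a) (hnt a),
    one_mul]

theorem integral_toReal_of_lintegral_ne_top {α : Type*} [MeasurableSpace α] {μ : Measure α}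
    {f : α → ℝ≥0∞} (hf : Measurable f) (hfi : ∫⁻ a, f a ∂μ ≠ ∞) :
    ∫ a, (f a).toReal ∂μ = (∫⁻ a, f a ∂μ).toReal :=
  integral_toReal hf.aemeasurable (ae_lt_top hf hfi)

/-- The lower integral over a half-open interval depends measurably on parameters. -/
theorem measurable_lintegral_Ioc {α : Type*} [MeasurableSpace α] {a b : α → ℝ}
    (ha : Measurable a) (hb : Measurable b) {f : α × ℝ → ℝ≥0∞} (hf : Measurable f) :
    Measurable fun p => ∫⁻ r in Ioc (a p) (b p), f (p, r) := by
  have hS : MeasurableSet {z : α × ℝ | a z.1 < z.2 ∧ z.2 ≤ b z.1} :=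
    (measurableSet_lt (ha.comp measurable_fst) measurable_snd).inter
      (measurableSet_le measurable_snd (hb.comp measurable_fst))
  have h := (hf.indicator hS).lintegral_prod_right' (ν := (volume : Measure ℝ))
  convert h using 2 with p
  rw [← lintegral_indicator measurableSet_Ioc]
  rfl

/-- Tonelli's theorem on a triangle. -/
theorem lintegral_Ioc_swap {G : ℝ → ℝ → ℝ≥0∞} (hG : Measurable (Function.uncurry G)) (s t : ℝ) :
    ∫⁻ u in Ioc s t, ∫⁻ r in Ioc s u, G u r = ∫⁻ r in Ioc s t, ∫⁻ u in Ioc r t, G u r := by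
  have hS : MeasurableSet {z : ℝ × ℝ | s < z.2 ∧ z.2 ≤ z.1 ∧ z.1 ≤ t} :=
    (measurableSet_lt measurable_const measurable_snd).inter
      ((measurableSet_le measurable_snd measurable_fst).inter
        (measurableSet_le measurable_fst measurable_const))
  set H : ℝ → ℝ → ℝ≥0∞ := fun u r =>
    {z : ℝ × ℝ | s < z.2 ∧ z.2 ≤ z.1 ∧ z.1 ≤ t}.indicator (Function.uncurry G) (u, r) with hH
  have hHm : Measurable (Function.uncurry H) := hG.indicator hS
  have hleft (u : ℝ) :
      (Ioc s t).indicator (fun u => ∫⁻ r in Ioc s u, G u r) u = ∫⁻ r, H u r := by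
    by_cases hu : u ∈ Ioc s t
    · rw [indicator_of_mem hu, ← lintegral_indicator measurableSet_Ioc]
      refine lintegral_congr fun r => ?_
      simp only [hH, indicator, mem_Ioc, mem_ofPred_eq, Function.uncurry]
      have := hu.2
      congr 1
      simp [this]
    · rw [indicator_of_notMem hu]
      symm
      rw [lintegral_eq_zero_of_ae_eq_zero]
      refine Filter.Eventually.of_forall fun r => ?_
      refine indicator_of_notMem ?_ _
      rintro ⟨h1, h2, h3⟩
      exact hu ⟨h1.trans_le h2, h3⟩
  have hright (r : ℝ) :
      (Ioc s t).indicator (fun r => ∫⁻ u in Ioc r t, G u r) r = ∫⁻ u, H u r := by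
    by_cases hr : r ∈ Ioc s t
    · rw [indicator_of_mem hr, Measure.restrict_congr_set Ioc_ae_eq_Icc,
        ← lintegral_indicator measurableSet_Icc]
      refine lintegral_congr fun u => ?_
      simp only [hH, indicator, mem_Icc, mem_ofPred_eq, Function.uncurry]
      have := hr.1
      congr 1
      simp [this]
    · rw [indicator_of_notMem hr]
      symm
      rw [lintegral_eq_zero_of_ae_eq_zero]
      refine Filter.Eventually.of_forall fun u => ?_
      refine indicator_of_notMem ?_ _
      rintro ⟨h1, h2, h3⟩
      exact hr ⟨h1, h2.trans h3⟩
  rw [← lintegral_indicator measurableSet_Ioc, ← lintegral_indicator measurableSet_Ioc,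
    lintegral_congr hleft, lintegral_congr hright]
  exact lintegral_lintegral_swap hHm.aemeasurable

/-- The survival probabilities of a continuous hazard rate solve the associated linear ODE. -/
theorem lintegral_rate_mul_exp {g : ℝ → ℝ} (hg : Continuous g) (hg0 : ∀ r, 0 ≤ g r) {s t : ℝ}
    (hst : s ≤ t) :
    ENNReal.ofReal (Real.exp (-∫ r in s..t, g r)) +
      ∫⁻ r in Ioc s t, ENNReal.ofReal (g r * Real.exp (-∫ τ in s..r, g τ)) = 1 := by
  have hI : Continuous fun r => ∫ τ in s..r, g τ := by
    exact intervalIntegral.continuous_primitive (fun a b => hg.intervalIntegrable a b) s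
  have hc : Continuous fun r => g r * Real.exp (-∫ τ in s..r, g τ) := by fun_prop
  have hd (r : ℝ) : HasDerivAt (fun r => -Real.exp (-∫ τ in s..r, g τ))
      (g r * Real.exp (-∫ τ in s..r, g τ)) r := by
    have h := (intervalIntegral.integral_hasDerivAt_right (hg.intervalIntegrable s r)
      (hg.stronglyMeasurableAtFilter _ _) hg.continuousAt).neg.exp.neg
    refine HasDerivAt.congr_deriv (f := fun r => -Real.exp (-∫ τ in s..r, g τ)) h ?_
    simp only [Pi.neg_apply]
    ring
  have hint := intervalIntegral.integral_eq_sub_of_hasDerivAt (fun r _ => hd r)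
    (hc.intervalIntegrable s t)
  have hnn : 0 ≤ ∫ r in s..t, g r * Real.exp (-∫ τ in s..r, g τ) :=
    intervalIntegral.integral_nonneg hst fun r _ => mul_nonneg (hg0 r) (Real.exp_pos _).le
  rw [← ofReal_integral_eq_lintegral_ofReal (hc.integrableOn_Ioc)
    (Filter.Eventually.of_forall fun r => mul_nonneg (hg0 r) (Real.exp_pos _).le),
    ← intervalIntegral.integral_of_le hst, ← ENNReal.ofReal_add (Real.exp_pos _).le hnn, hint]
  simp

/-- A measurable family of finite jump measures, defined for all real times, whose total
intensity is continuous in time. -/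
structure IsContinuousRate [MeasurableSpace E] (Q : ℝ → E → Measure E) : Prop where
  finite : ∀ t x, IsFiniteMeasure (Q t x)
  measurable : Measurable fun p : ℝ × E => Q p.1 p.2
  continuous : ∀ x, Continuous fun t => qIntensity Q t x

/-- The probability of not having jumped from `x` during `[s,t]`. -/
noncomputable def survival [MeasurableSpace E] (Q : ℝ → E → Measure E) (s t : ℝ) (x : E) : ℝ≥0∞ :=
  ENNReal.ofReal (Real.exp (-∫ r in s..t, qIntensity Q r x))

/-- The terms of the right-hand side of the forward equation: the initial value, followed by the
mass flowing in through the `n`-th jump. -/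
noncomputable def inflow [MeasurableSpace E] (Q : ℝ → E → Measure E) (f : E → ℝ≥0∞) (s t : ℝ)
    (x : E) : ℕ → ℝ≥0∞
  | 0 => f x
  | n + 1 => ∫⁻ u in Ioc s t, ∫⁻ y, ∫⁻ z, f z ∂(Q u y) ∂(Piter Q n s u x)

theorem qIntensity_nonneg [MeasurableSpace E] (Q : ℝ → E → Measure E) (t : ℝ) (x : E) :
    0 ≤ qIntensity Q t x := ENNReal.toReal_nonneg

namespace IsContinuousRate

variable [MeasurableSpace E] {Q : ℝ → E → Measure E}

theorem ofReal_qIntensity (h : IsContinuousRate Q) (t : ℝ) (x : E) :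
    ENNReal.ofReal (qIntensity Q t x) = Q t x univ := by
  have := h.finite t x
  exact ENNReal.ofReal_toReal (measure_ne_top _ _)

theorem measurable_mass (h : IsContinuousRate Q) :
    Measurable fun p : ℝ × E => Q p.1 p.2 univ :=
  (Measure.measurable_coe MeasurableSet.univ).comp h.measurable

theorem measurable_survival (h : IsContinuousRate Q) :
    Measurable fun p : ℝ × ℝ × E => survival Q p.1 p.2.1 p.2.2 := by
  have hq : Measurable fun p : ℝ × E => qIntensity Q p.1 p.2 := h.measurable_mass.ennreal_toReal
  have hI : Measurable fun p : ℝ × ℝ × E =>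
      ∫ θ in (0 : ℝ)..1, qIntensity Q (p.1 + (p.2.1 - p.1) * θ) p.2.2 := by
    simp_rw [intervalIntegral.integral_of_le (zero_le_one' ℝ)]
    refine StronglyMeasurable.measurable (StronglyMeasurable.integral_prod_right
      (f := fun (p : ℝ × ℝ × E) (θ : ℝ) => qIntensity Q (p.1 + (p.2.1 - p.1) * θ) p.2.2) ?_)
    refine Measurable.stronglyMeasurable ?_
    exact hq.comp (f := fun z : (ℝ × ℝ × E) × ℝ => (z.1.1 + (z.1.2.1 - z.1.1) * z.2, z.1.2.2))
      (by fun_prop)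
  have heq (p : ℝ × ℝ × E) : ∫ r in p.1..p.2.1, qIntensity Q r p.2.2 =
      (p.2.1 - p.1) * ∫ θ in (0 : ℝ)..1, qIntensity Q (p.1 + (p.2.1 - p.1) * θ) p.2.2 := by
    have := intervalIntegral.smul_integral_comp_add_mul (a := 0) (b := 1)
      (fun r => qIntensity Q r p.2.2) (p.2.1 - p.1) p.1
    simpa using this.symm
  simp only [survival, heq]
  fun_prop

theorem measurable_lintegral (h : IsContinuousRate Q) {α : Type*} [MeasurableSpace α]
    {t : α → ℝ} {x : α → E} (ht : Measurable t) (hx : Measurable x) {f : α × E → ℝ≥0∞}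
    (hf : Measurable f) : Measurable fun a => ∫⁻ y, f (a, y) ∂(Q (t a) (x a)) :=
  measurable_lintegral_of_forall_isFiniteMeasure (m := fun a => Q (t a) (x a))
    (h.measurable.comp (ht.prodMk hx)) (fun _ => h.finite _ _) hf

theorem Piter_succ_eq (n : ℕ) (s t : ℝ) (x : E) :
    Piter Q (n + 1) s t x = Measure.bind
        ((volume.restrict (Ioc s t)).withDensity fun r => survival Q s r x)
        fun r => Measure.bind (Q r x) fun y => Piter Q n r t y := rfl

theorem measurable_bind (h : IsContinuousRate Q) {n : ℕ}
    (hn : Measurable fun p : ℝ × ℝ × E => Piter Q n p.1 p.2.1 p.2.2) (t : ℝ) (x : E) :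
    Measurable fun r => Measure.bind (Q r x) fun y => Piter Q n r t y := by
  refine Measure.measurable_of_measurable_coe _ fun A hA => ?_
  have hin (r : ℝ) : Measure.bind (Q r x) (fun y => Piter Q n r t y) A =
      ∫⁻ y, Piter Q n r t y A ∂(Q r x) :=
    Measure.bind_apply hA (hn.comp (f := fun y => (r, t, y)) (by fun_prop)).aemeasurable
  simp_rw [hin]
  exact h.measurable_lintegral (f := fun p : ℝ × E => Piter Q n p.1 t p.2 A) measurable_id
    measurable_const (((Measure.measurable_coe hA).comp hn).comp
      (f := fun p : ℝ × E => (p.1, t, p.2)) (by fun_prop))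

theorem lintegral_Piter_succ_of_measurable (h : IsContinuousRate Q) {n : ℕ}
    (hn : Measurable fun p : ℝ × ℝ × E => Piter Q n p.1 p.2.1 p.2.2) (s t : ℝ) (x : E)
    {f : E → ℝ≥0∞} (hf : Measurable f) :
    ∫⁻ z, f z ∂(Piter Q (n + 1) s t x) =
      ∫⁻ r in Ioc s t, survival Q s r x * ∫⁻ y, ∫⁻ z, f z ∂(Piter Q n r t y) ∂(Q r x) := by
  have hS : Measurable fun r => survival Q s r x :=
    h.measurable_survival.comp (f := fun r => (s, r, x)) (by fun_prop)
  have hb := h.measurable_bind hn t x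
  have hbf : Measurable fun r => ∫⁻ z, f z ∂(Measure.bind (Q r x) fun y => Piter Q n r t y) :=
    (Measure.measurable_lintegral hf).comp hb
  rw [Piter_succ_eq, Measure.lintegral_bind hb.aemeasurable hf.aemeasurable,
    lintegral_withDensity_eq_lintegral_mul _ hS hbf]
  refine lintegral_congr fun r => ?_
  simp only [Pi.mul_apply]
  have hnr : Measurable fun y => Piter Q n r t y :=
    hn.comp (f := fun y => (r, t, y)) (by fun_prop)
  rw [Measure.lintegral_bind hnr.aemeasurable hf.aemeasurable]

theorem measurable_Piter (h : IsContinuousRate Q) (n : ℕ) :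
    Measurable fun p : ℝ × ℝ × E => Piter Q n p.1 p.2.1 p.2.2 := by
  induction n with
  | zero =>
    refine Measure.measurable_of_measurable_coe _ fun A hA => ?_
    change Measurable fun p : ℝ × ℝ × E => survival Q p.1 p.2.1 p.2.2 * Measure.dirac p.2.2 A
    exact h.measurable_survival.mul
      ((Measure.measurable_coe hA).comp (Measure.measurable_dirac.comp (by fun_prop)))
  | succ n ih =>
    refine Measure.measurable_of_measurable_coe _ fun A hA => ?_
    have hA' : Measurable fun p : ℝ × ℝ × E => Piter Q n p.1 p.2.1 p.2.2 A :=
      (Measure.measurable_coe hA).comp ih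
    have heq (p : ℝ × ℝ × E) : Piter Q (n + 1) p.1 p.2.1 p.2.2 A =
        ∫⁻ r in Ioc p.1 p.2.1, survival Q p.1 r p.2.2 *
          ∫⁻ y, Piter Q n r p.2.1 y A ∂(Q r p.2.2) := by
      rw [← lintegral_indicator_one hA, h.lintegral_Piter_succ_of_measurable ih _ _ _
        (measurable_one.indicator hA)]
      simp_rw [lintegral_indicator_one hA]
    simp_rw [heq]
    refine measurable_lintegral_Ioc (f := fun z : (ℝ × ℝ × E) × ℝ => survival Q z.1.1 z.2 z.1.2.2 *
      ∫⁻ y, Piter Q n z.2 z.1.2.1 y A ∂(Q z.2 z.1.2.2)) (by fun_prop) (by fun_prop) ?_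
    refine Measurable.mul ?_ ?_
    · exact h.measurable_survival.comp (f := fun z : (ℝ × ℝ × E) × ℝ => (z.1.1, z.2, z.1.2.2))
        (by fun_prop)
    · exact h.measurable_lintegral (f := fun z : ((ℝ × ℝ × E) × ℝ) × E =>
        Piter Q n z.1.2 z.1.1.2.1 z.2 A) (by fun_prop) (by fun_prop)
        (hA'.comp (f := fun z : ((ℝ × ℝ × E) × ℝ) × E => (z.1.2, z.1.1.2.1, z.2)) (by fun_prop))

theorem lintegral_Piter_zero (s t : ℝ) (x : E) {f : E → ℝ≥0∞} (hf : Measurable f) :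
    ∫⁻ z, f z ∂(Piter Q 0 s t x) = survival Q s t x * f x := by
  change ∫⁻ z, f z ∂(survival Q s t x • Measure.dirac x) = _
  rw [lintegral_smul_measure, lintegral_dirac' _ hf, smul_eq_mul]

theorem lintegral_Piter_succ (h : IsContinuousRate Q) (n : ℕ) (s t : ℝ) (x : E)
    {f : E → ℝ≥0∞} (hf : Measurable f) :
    ∫⁻ z, f z ∂(Piter Q (n + 1) s t x) =
      ∫⁻ r in Ioc s t, survival Q s r x * ∫⁻ y, ∫⁻ z, f z ∂(Piter Q n r t y) ∂(Q r x) :=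
  h.lintegral_Piter_succ_of_measurable (h.measurable_Piter n) s t x hf

/-- A Lyapunov function grows at most exponentially along the iterated kernels. -/
theorem sum_lintegral_Piter_le (h : IsContinuousRate Q) {v : E → ℝ} (hv : Measurable v)
    (hv0 : ∀ x, 0 ≤ v x) {c : ℝ → ℝ} (hc : Continuous c) (hc0 : ∀ t, 0 ≤ c t)
    (hL : ∀ t x, ∫⁻ y, ENNReal.ofReal (v y) ∂(Q t x) ≤
      ENNReal.ofReal (c t * v x + qIntensity Q t x * v x))
    (N : ℕ) {s t : ℝ} (hst : s ≤ t) (x : E) :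
    ∑ n ∈ Finset.range N, ∫⁻ y, ENNReal.ofReal (v y) ∂(Piter Q n s t x) ≤
      ENNReal.ofReal (v x * Real.exp (∫ τ in s..t, c τ)) := by
  induction N generalizing s x with
  | zero => simp
  | succ N ih =>
    have hvm : Measurable fun y => ENNReal.ofReal (v y) := hv.ennreal_ofReal
    have hPm (n : ℕ) : Measurable fun p : ℝ × ℝ × E =>
        ∫⁻ z, ENNReal.ofReal (v z) ∂(Piter Q n p.1 p.2.1 p.2.2) :=
      (Measure.measurable_lintegral hvm).comp (h.measurable_Piter n)
    set g : ℝ → ℝ := fun r => c r + qIntensity Q r x with hg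
    have hgc : Continuous g := hc.add (h.continuous x)
    have hg0 (r : ℝ) : 0 ≤ g r := add_nonneg (hc0 r) (qIntensity_nonneg Q r x)
    have hci (a b : ℝ) : IntervalIntegrable c volume a b := hc.intervalIntegrable a b
    have hqi (a b : ℝ) : IntervalIntegrable (fun r => qIntensity Q r x) volume a b :=
      (h.continuous x).intervalIntegrable a b
    have hgi (a b : ℝ) : ∫ r in a..b, g r = (∫ r in a..b, c r) + ∫ r in a..b, qIntensity Q r x :=
      intervalIntegral.integral_add (hci a b) (hqi a b)
    set K := ENNReal.ofReal (v x * Real.exp (∫ τ in s..t, c τ)) with hK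
    have hK0 : 0 ≤ v x * Real.exp (∫ τ in s..t, c τ) := mul_nonneg (hv0 x) (Real.exp_pos _).le
    rw [Finset.sum_range_succ', lintegral_Piter_zero _ _ _ hvm, add_comm]
    have h0 : survival Q s t x * ENNReal.ofReal (v x) =
        K * ENNReal.ofReal (Real.exp (-∫ r in s..t, g r)) := by
      rw [survival, hK, ← ENNReal.ofReal_mul (Real.exp_pos _).le, ← ENNReal.ofReal_mul hK0, hgi,
        mul_assoc, ← Real.exp_add, mul_comm]
      congr 3
      ring
    have hstep : ∑ n ∈ Finset.range N, ∫⁻ y, ENNReal.ofReal (v y) ∂(Piter Q (n + 1) s t x) ≤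
        ∫⁻ r in Ioc s t, K * ENNReal.ofReal (g r * Real.exp (-∫ τ in s..r, g τ)) := by
      simp_rw [h.lintegral_Piter_succ _ _ _ _ hvm]
      rw [← lintegral_finsetSum]
      swap
      · intro n _
        refine Measurable.mul ?_ ?_
        · exact h.measurable_survival.comp (f := fun r => (s, r, x)) (by fun_prop)
        · exact h.measurable_lintegral (f := fun p : ℝ × E =>
            ∫⁻ z, ENNReal.ofReal (v z) ∂(Piter Q n p.1 t p.2)) measurable_id measurable_const
            ((hPm n).comp (f := fun p : ℝ × E => (p.1, t, p.2)) (by fun_prop))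
      refine setLIntegral_mono' measurableSet_Ioc fun r hr => ?_
      rw [← Finset.mul_sum, ← lintegral_finsetSum]
      swap
      · exact fun n _ => (hPm n).comp (f := fun y => (r, t, y)) (by fun_prop)
      calc survival Q s r x * ∫⁻ y, ∑ n ∈ Finset.range N,
            ∫⁻ z, ENNReal.ofReal (v z) ∂(Piter Q n r t y) ∂(Q r x)
          ≤ survival Q s r x *
            ∫⁻ y, ENNReal.ofReal (v y) * ENNReal.ofReal (Real.exp (∫ τ in r..t, c τ)) ∂(Q r x) := by
            gcongr with y
            rw [← ENNReal.ofReal_mul (hv0 y)]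
            exact ih hr.2 y
        _ ≤ survival Q s r x * (ENNReal.ofReal (c r * v x + qIntensity Q r x * v x) *
            ENNReal.ofReal (Real.exp (∫ τ in r..t, c τ))) := by
            rw [lintegral_mul_const _ hvm]
            gcongr
            exact hL r x
        _ = K * ENNReal.ofReal (g r * Real.exp (-∫ τ in s..r, g τ)) := by
            have hcs := intervalIntegral.integral_add_adjacent_intervals (hci s r) (hci r t)
            have hgv : c r * v x + qIntensity Q r x * v x = g r * v x := by rw [hg]; ring
            rw [survival, hK, hgv, ← ENNReal.ofReal_mul (mul_nonneg (hg0 r) (hv0 x)),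
              ← ENNReal.ofReal_mul (Real.exp_pos _).le, ← ENNReal.ofReal_mul hK0, hgi, ← hcs,
              neg_add, Real.exp_add, Real.exp_add, Real.exp_neg (∫ r in s..r, c r)]
            congr 1
            field_simp
    calc _ ≤ K * ENNReal.ofReal (Real.exp (-∫ r in s..t, g r)) +
          ∫⁻ r in Ioc s t, K * ENNReal.ofReal (g r * Real.exp (-∫ τ in s..r, g τ)) := by
          rw [h0]
          gcongr
      _ = K := by
          rw [lintegral_const_mul' _ _ ENNReal.ofReal_ne_top, ← mul_add,
            lintegral_rate_mul_exp hgc hg0 hst, mul_one]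

theorem lintegral_Pmin_le (h : IsContinuousRate Q) {v : E → ℝ} (hv : Measurable v)
    (hv0 : ∀ x, 0 ≤ v x) {c : ℝ → ℝ} (hc : Continuous c) (hc0 : ∀ t, 0 ≤ c t)
    (hL : ∀ t x, ∫⁻ y, ENNReal.ofReal (v y) ∂(Q t x) ≤
      ENNReal.ofReal (c t * v x + qIntensity Q t x * v x))
    {s t : ℝ} (hst : s ≤ t) (x : E) :
    ∫⁻ y, ENNReal.ofReal (v y) ∂(Pmin Q s t x) ≤
      ENNReal.ofReal (v x * Real.exp (∫ τ in s..t, c τ)) := by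
  rw [Pmin, lintegral_sum_measure, ENNReal.tsum_eq_iSup_nat]
  exact iSup_le fun N => h.sum_lintegral_Piter_le hv hv0 hc hc0 hL N hst x

theorem Pmin_univ_le (h : IsContinuousRate Q) {s t : ℝ} (hst : s ≤ t) (x : E) :
    Pmin Q s t x univ ≤ 1 := by
  have := h.lintegral_Pmin_le (v := fun _ => 1) measurable_const (fun _ => zero_le_one)
    (c := fun _ => 0) continuous_const (fun _ => le_rfl)
    (fun t x => by simp [h.ofReal_qIntensity]) hst x
  simpa using this

theorem isFiniteMeasure_Pmin (h : IsContinuousRate Q) {s t : ℝ} (hst : s ≤ t) (x : E) :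
    IsFiniteMeasure (Pmin Q s t x) :=
  ⟨(h.Pmin_univ_le hst x).trans_lt ENNReal.one_lt_top⟩

theorem isFiniteMeasure_Piter (h : IsContinuousRate Q) (n : ℕ) (s t : ℝ) (x : E) :
    IsFiniteMeasure (Piter Q n s t x) := by
  rcases le_or_gt s t with hst | hts
  · have := h.isFiniteMeasure_Pmin hst x
    exact isFiniteMeasure_of_le (Pmin Q s t x) (Measure.le_sum _ n)
  · cases n with
    | zero => exact ⟨by simp [Piter]⟩
    | succ n =>
      refine ⟨?_⟩
      rw [← lintegral_one, h.lintegral_Piter_succ n s t x measurable_const,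
        Ioc_eq_empty_of_le hts.le]
      simp

theorem measurable_lintegral_Piter (h : IsContinuousRate Q) (n : ℕ) {α : Type*}
    [MeasurableSpace α] {s t : α → ℝ} {x : α → E} (hs : Measurable s) (ht : Measurable t)
    (hx : Measurable x) {f : α × E → ℝ≥0∞} (hf : Measurable f) :
    Measurable fun a => ∫⁻ y, f (a, y) ∂(Piter Q n (s a) (t a) (x a)) :=
  measurable_lintegral_of_forall_isFiniteMeasure
    (m := fun a => Piter Q n (s a) (t a) (x a))
    ((h.measurable_Piter n).comp (hs.prodMk (ht.prodMk hx)))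
    (fun _ => h.isFiniteMeasure_Piter n _ _ _) hf

theorem measurable_lintegral_Pmin (h : IsContinuousRate Q) {f : ℝ × E → ℝ≥0∞}
    (hf : Measurable f) (s : ℝ) (x : E) :
    Measurable fun u => ∫⁻ y, f (u, y) ∂(Pmin Q s u x) := by
  simp only [Pmin, lintegral_sum_measure]
  exact Measurable.tsum fun n =>
    h.measurable_lintegral_Piter n measurable_const measurable_id measurable_const hf

/-- The backward recursion, integrated over the terminal time. -/
theorem lintegral_lintegral_Piter_succ (h : IsContinuousRate Q) (n : ℕ) (s t : ℝ) (x : E)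
    {f : ℝ × E → ℝ≥0∞} (hf : Measurable f) :
    ∫⁻ u in Ioc s t, ∫⁻ y, f (u, y) ∂(Piter Q (n + 1) s u x) =
      ∫⁻ r in Ioc s t, survival Q s r x *
        ∫⁻ y, (∫⁻ u in Ioc r t, ∫⁻ z, f (u, z) ∂(Piter Q n r u y)) ∂(Q r x) := by
  have hm : Measurable fun p : (ℝ × ℝ) × E =>
      ∫⁻ z, f (p.1.1, z) ∂(Piter Q n p.1.2 p.1.1 p.2) :=
    h.measurable_lintegral_Piter n (f := fun q : ((ℝ × ℝ) × E) × E => f (q.1.1.1, q.2))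
      (by fun_prop) (by fun_prop) (by fun_prop) (hf.comp (by fun_prop))
  have hm2 : Measurable fun p : ℝ × ℝ =>
      ∫⁻ y, ∫⁻ z, f (p.1, z) ∂(Piter Q n p.2 p.1 y) ∂(Q p.2 x) :=
    h.measurable_lintegral (by fun_prop) measurable_const hm
  have hS : Measurable fun p : ℝ × ℝ => survival Q s p.2 x :=
    h.measurable_survival.comp (f := fun p : ℝ × ℝ => (s, p.2, x)) (by fun_prop)
  calc _ = ∫⁻ u in Ioc s t, ∫⁻ r in Ioc s u, survival Q s r x *
          ∫⁻ y, ∫⁻ z, f (u, z) ∂(Piter Q n r u y) ∂(Q r x) :=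
        lintegral_congr fun u =>
          h.lintegral_Piter_succ n s u x (hf.comp (f := fun z => (u, z)) (by fun_prop))
    _ = ∫⁻ r in Ioc s t, ∫⁻ u in Ioc r t, survival Q s r x *
          ∫⁻ y, ∫⁻ z, f (u, z) ∂(Piter Q n r u y) ∂(Q r x) :=
        lintegral_Ioc_swap (G := fun u r => survival Q s r x *
          ∫⁻ y, ∫⁻ z, f (u, z) ∂(Piter Q n r u y) ∂(Q r x)) (hS.mul hm2) s t
    _ = _ := by
        refine lintegral_congr fun r => ?_
        have := h.finite r x
        have htop : survival Q s r x ≠ ∞ := ENNReal.ofReal_ne_top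
        rw [lintegral_const_mul' _ _ htop, lintegral_lintegral_swap]
        exact (hm.comp (f := fun q : ℝ × E => ((q.1, r), q.2)) (by fun_prop)).aemeasurable

/-- The forward equation for a single iterated kernel. -/
theorem lintegral_Piter_add_rate (h : IsContinuousRate Q) {f : E → ℝ≥0∞} (hf : Measurable f)
    (n : ℕ) {s t : ℝ} (hst : s ≤ t) (x : E) :
    ∫⁻ y, f y ∂(Piter Q n s t x) +
        ∫⁻ u in Ioc s t, ∫⁻ y, Q u y univ * f y ∂(Piter Q n s u x) =
      inflow Q f s t x n := by
  have hqf : Measurable fun p : ℝ × E => Q p.1 p.2 univ * f p.2 :=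
    h.measurable_mass.mul (hf.comp measurable_snd)
  have hQf : Measurable fun p : ℝ × E => ∫⁻ z, f z ∂(Q p.1 p.2) :=
    h.measurable_lintegral measurable_fst measurable_snd
      (f := fun q : (ℝ × E) × E => f q.2) (hf.comp measurable_snd)
  induction n generalizing s x with
  | zero =>
    have hrate := lintegral_rate_mul_exp (h.continuous x) (fun r => qIntensity_nonneg Q r x) hst
    have heq (u : ℝ) : ∫⁻ y, Q u y univ * f y ∂(Piter Q 0 s u x) =
        ENNReal.ofReal (qIntensity Q u x * Real.exp (-∫ τ in s..u, qIntensity Q τ x)) * f x := by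
      have hqu : Measurable fun y => Q u y univ * f y :=
        hqf.comp (f := fun y => (u, y)) (by fun_prop)
      rw [lintegral_Piter_zero _ _ _ hqu,
        ENNReal.ofReal_mul (qIntensity_nonneg Q u x), h.ofReal_qIntensity, survival]
      ring
    have hm : Measurable fun u =>
        ENNReal.ofReal (qIntensity Q u x * Real.exp (-∫ τ in s..u, qIntensity Q τ x)) := by
      have hI : Continuous fun u => ∫ τ in s..u, qIntensity Q τ x :=
        intervalIntegral.continuous_primitive
          (fun a b => (h.continuous x).intervalIntegrable a b) s
      exact ((h.continuous x).mul (Real.continuous_exp.comp hI.neg)).measurable.ennreal_ofReal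
    simp_rw [heq]
    rw [lintegral_Piter_zero _ _ _ hf, lintegral_mul_const _ hm, survival, ← add_mul, hrate,
      one_mul, inflow]
  | succ n ih =>
    have hPm : Measurable fun p : ℝ × E => ∫⁻ z, f z ∂(Piter Q n p.1 t p.2) :=
      h.measurable_lintegral_Piter n (f := fun q : (ℝ × E) × E => f q.2)
        measurable_fst measurable_const measurable_snd (hf.comp measurable_snd)
    have hS : Measurable fun r => survival Q s r x :=
      h.measurable_survival.comp (f := fun r => (s, r, x)) (by fun_prop)
    have hm : Measurable fun r =>
        survival Q s r x * ∫⁻ y, ∫⁻ z, f z ∂(Piter Q n r t y) ∂(Q r x) :=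
      hS.mul (h.measurable_lintegral (f := fun p : ℝ × E => ∫⁻ z, f z ∂(Piter Q n p.1 t p.2))
        measurable_id measurable_const hPm)
    rw [h.lintegral_Piter_succ n s t x hf, h.lintegral_lintegral_Piter_succ n s t x hqf,
      ← lintegral_add_left hm]
    have hstep : ∀ r ∈ Ioc s t,
        survival Q s r x * ∫⁻ y, ∫⁻ z, f z ∂(Piter Q n r t y) ∂(Q r x) +
          survival Q s r x *
            ∫⁻ y, (∫⁻ u in Ioc r t, ∫⁻ z, Q u z univ * f z ∂(Piter Q n r u y)) ∂(Q r x) =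
        survival Q s r x * ∫⁻ y, inflow Q f r t y n ∂(Q r x) := by
      intro r hr
      have hPr : Measurable fun y => ∫⁻ z, f z ∂(Piter Q n r t y) :=
        hPm.comp (f := fun y => (r, y)) (by fun_prop)
      rw [← mul_add, ← lintegral_add_left hPr]
      congr 1
      exact lintegral_congr fun y => ih hr.2 y
    rw [setLIntegral_congr_fun measurableSet_Ioc hstep]
    cases n with
    | zero =>
      refine lintegral_congr fun r => ?_
      have hQr : Measurable fun y => ∫⁻ z, f z ∂(Q r y) :=
        hQf.comp (f := fun y => (r, y)) (by fun_prop)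
      rw [lintegral_Piter_zero _ _ _ hQr]
      rfl
    | succ m => exact (h.lintegral_lintegral_Piter_succ m s t x hQf).symm

/-- The forward equation for the minimal transition function, with all terms nonnegative. -/
theorem lintegral_Pmin_add_rate (h : IsContinuousRate Q) {f : E → ℝ≥0∞} (hf : Measurable f)
    {s t : ℝ} (hst : s ≤ t) (x : E) :
    ∫⁻ y, f y ∂(Pmin Q s t x) +
        ∫⁻ u in Ioc s t, ∫⁻ y, Q u y univ * f y ∂(Pmin Q s u x) =
      f x + ∫⁻ u in Ioc s t, ∫⁻ y, ∫⁻ z, f z ∂(Q u y) ∂(Pmin Q s u x) := by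
  have hqf : Measurable fun p : ℝ × E => Q p.1 p.2 univ * f p.2 :=
    h.measurable_mass.mul (hf.comp measurable_snd)
  have hQf : Measurable fun p : ℝ × E => ∫⁻ z, f z ∂(Q p.1 p.2) :=
    h.measurable_lintegral measurable_fst measurable_snd
      (f := fun q : (ℝ × E) × E => f q.2) (hf.comp measurable_snd)
  have hm {k : ℝ × E → ℝ≥0∞} (hk : Measurable k) (n : ℕ) :
      Measurable fun u => ∫⁻ y, k (u, y) ∂(Piter Q n s u x) :=
    h.measurable_lintegral_Piter n measurable_const measurable_id measurable_const hk
  simp only [Pmin, lintegral_sum_measure]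
  rw [lintegral_tsum fun n => (hm hqf n).aemeasurable,
    lintegral_tsum fun n => (hm hQf n).aemeasurable, ← ENNReal.tsum_add,
    tsum_congr fun n => h.lintegral_Piter_add_rate hf n hst x,
    tsum_eq_zero_add' ENNReal.summable]
  rfl

/-- The forward equation for a nonnegative bounded function. -/
theorem Umin_eq_of_nonneg (h : IsContinuousRate Q) {G : E → ℝ} (hG : Measurable G)
    (hG0 : ∀ y, 0 ≤ G y) {M : ℝ} (hGM : ∀ y, G y ≤ M) {s t : ℝ} (hst : s ≤ t) (x : E)
    {K : ℝ≥0∞} (hK : K ≠ ∞)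
    (hrate : ∀ u ∈ Ioc s t, ∫⁻ y, Q u y univ ∂(Pmin Q s u x) ≤ K) :
    IntegrableOn (fun r => ∫ y, Lgen Q r G y ∂(Pmin Q s r x)) (Ioc s t) ∧
      Umin Q s t G x = G x + ∫ r in s..t, ∫ y, Lgen Q r G y ∂(Pmin Q s r x) := by
  set g : E → ℝ≥0∞ := fun y => ENNReal.ofReal (G y) with hg
  have hgm : Measurable g := hG.ennreal_ofReal
  have hgM (y : E) : g y ≤ ENNReal.ofReal M := ENNReal.ofReal_le_ofReal (hGM y)
  have hgG (y : E) : (g y).toReal = G y := ENNReal.toReal_ofReal (hG0 y)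
  have hlint (μ : Measure E) : ∫ y, G y ∂μ = (∫⁻ y, g y ∂μ).toReal :=
    integral_eq_lintegral_of_nonneg_ae (Filter.Eventually.of_forall hG0) hG.aestronglyMeasurable
  have hGint (μ : Measure E) [IsFiniteMeasure μ] : Integrable G μ :=
    Integrable.of_bound hG.aestronglyMeasurable M (Filter.Eventually.of_forall fun y => by
      rw [Real.norm_of_nonneg (hG0 y)]; exact hGM y)
  set a : ℝ × E → ℝ≥0∞ := fun p => ∫⁻ z, g z ∂(Q p.1 p.2) with ha
  set b : ℝ × E → ℝ≥0∞ := fun p => Q p.1 p.2 univ * g p.2 with hb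
  have ham : Measurable a := h.measurable_lintegral measurable_fst measurable_snd
    (f := fun q : (ℝ × E) × E => g q.2) (hgm.comp measurable_snd)
  have hbm : Measurable b := h.measurable_mass.mul (hgm.comp measurable_snd)
  have haM (p : ℝ × E) : a p ≤ ENNReal.ofReal M * Q p.1 p.2 univ :=
    (lintegral_mono hgM).trans_eq (lintegral_const _)
  have hbM (p : ℝ × E) : b p ≤ ENNReal.ofReal M * Q p.1 p.2 univ := by
    rw [mul_comm (ENNReal.ofReal M)]
    exact mul_le_mul_right (hgM p.2) _
  have hbound {k : ℝ × E → ℝ≥0∞} (hk : ∀ p, k p ≤ ENNReal.ofReal M * Q p.1 p.2 univ) (u : ℝ)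
      (hu : u ∈ Ioc s t) : ∫⁻ y, k (u, y) ∂(Pmin Q s u x) ≤ ENNReal.ofReal M * K := by
    calc _ ≤ ∫⁻ y, ENNReal.ofReal M * Q u y univ ∂(Pmin Q s u x) := lintegral_mono fun y => hk _
      _ = ENNReal.ofReal M * ∫⁻ y, Q u y univ ∂(Pmin Q s u x) :=
        lintegral_const_mul' _ _ ENNReal.ofReal_ne_top
      _ ≤ _ := by gcongr; exact hrate u hu
  have hMK : ENNReal.ofReal M * K < ∞ := ENNReal.mul_lt_top ENNReal.ofReal_lt_top hK.lt_top
  have hbound' {k : ℝ × E → ℝ≥0∞} (hk : ∀ p, k p ≤ ENNReal.ofReal M * Q p.1 p.2 univ) :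
      ∫⁻ u in Ioc s t, ∫⁻ y, k (u, y) ∂(Pmin Q s u x) ≠ ∞ := by
    refine ((setLIntegral_mono' measurableSet_Ioc (hbound hk)).trans_lt ?_).ne
    rw [lintegral_const]
    exact ENNReal.mul_lt_top hMK (by simp)
  have hL (u : ℝ) (y : E) : Lgen Q u G y = (a (u, y)).toReal - (b (u, y)).toReal := by
    have := h.finite u y
    rw [Lgen, integral_sub (hGint _) (integrable_const _), hlint, integral_const, smul_eq_mul, hb,
      ENNReal.toReal_mul, hgG]
    rfl
  have hJ : ∀ u ∈ Ioc s t, ∫ y, Lgen Q u G y ∂(Pmin Q s u x) =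
      (∫⁻ y, a (u, y) ∂(Pmin Q s u x)).toReal - (∫⁻ y, b (u, y) ∂(Pmin Q s u x)).toReal := by
    intro u hu
    have hau : Measurable fun y => a (u, y) := ham.comp measurable_prodMk_left
    have hbu : Measurable fun y => b (u, y) := hbm.comp measurable_prodMk_left
    have hau' := ((hbound haM u hu).trans_lt hMK).ne
    have hbu' := ((hbound hbM u hu).trans_lt hMK).ne
    simp_rw [hL]
    rw [integral_sub (integrable_toReal_of_lintegral_ne_top hau.aemeasurable hau')
      (integrable_toReal_of_lintegral_ne_top hbu.aemeasurable hbu'),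
      integral_toReal_of_lintegral_ne_top hau hau', integral_toReal_of_lintegral_ne_top hbu hbu']
  have hA := h.measurable_lintegral_Pmin ham s x
  have hB := h.measurable_lintegral_Pmin hbm s x
  have hAi := integrable_toReal_of_lintegral_ne_top hA.aemeasurable (hbound' haM)
  have hBi := integrable_toReal_of_lintegral_ne_top hB.aemeasurable (hbound' hbM)
  refine ⟨(integrableOn_congr_fun hJ measurableSet_Ioc).2 (hAi.sub hBi), ?_⟩
  rw [intervalIntegral.integral_of_le hst, setIntegral_congr_fun measurableSet_Ioc hJ,
    integral_sub hAi hBi, integral_toReal_of_lintegral_ne_top hA (hbound' haM),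
    integral_toReal_of_lintegral_ne_top hB (hbound' hbM), Umin, hlint, ← hgG x]
  have hP : ∫⁻ y, g y ∂(Pmin Q s t x) ≠ ∞ := by
    refine ((lintegral_mono hgM).trans_lt ?_).ne
    rw [lintegral_const]
    exact ENNReal.mul_lt_top ENNReal.ofReal_lt_top
      ((h.Pmin_univ_le hst x).trans_lt ENNReal.one_lt_top)
  have key := congrArg ENNReal.toReal (h.lintegral_Pmin_add_rate hgm hst x)
  rw [ENNReal.toReal_add hP (hbound' hbM),
    ENNReal.toReal_add ENNReal.ofReal_ne_top (hbound' haM)] at key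
  linarith

/-- The forward equation for a bounded measurable function. -/
theorem Umin_eq (h : IsContinuousRate Q) {F : E → ℝ} (hF : Measurable F) {M : ℝ}
    (hFM : ∀ y, |F y| ≤ M) {s t : ℝ} (hst : s ≤ t) (x : E) {K : ℝ≥0∞} (hK : K ≠ ∞)
    (hrate : ∀ u ∈ Ioc s t, ∫⁻ y, Q u y univ ∂(Pmin Q s u x) ≤ K) :
    IntegrableOn (fun r => ∫ y, Lgen Q r F y ∂(Pmin Q s r x)) (Ioc s t) ∧
      Umin Q s t F x = F x + ∫ r in s..t, ∫ y, Lgen Q r F y ∂(Pmin Q s r x) := by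
  have hM : 0 ≤ M := (abs_nonneg _).trans (hFM x)
  have hfin := h.isFiniteMeasure_Pmin hst x
  have hFi : Integrable F (Pmin Q s t x) :=
    Integrable.of_bound hF.aestronglyMeasurable M (Filter.Eventually.of_forall hFM)
  obtain ⟨-, h1⟩ := h.Umin_eq_of_nonneg (G := fun _ => M) measurable_const (fun _ => hM)
    (fun _ => le_rfl) hst x hK hrate
  obtain ⟨hi, h2⟩ := h.Umin_eq_of_nonneg (G := fun y => F y + M) (hF.add_const M)
    (fun y => by linarith [neg_abs_le (F y), hFM y])
    (fun y => add_le_add_left ((le_abs_self _).trans (hFM y)) M) hst x hK hrate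
  have hL (r : ℝ) : Lgen Q r (fun y => F y + M) = Lgen Q r F := by
    ext y
    simp [Lgen]
  simp only [hL] at hi h2
  refine ⟨hi, ?_⟩
  simp only [Umin, Lgen, sub_self, integral_zero, intervalIntegral.integral_zero, add_zero] at h1
  rw [Umin, integral_add hFi (integrable_const M), h1] at h2
  rw [Umin]
  linarith

end IsContinuousRate

theorem Piter_congr [MeasurableSpace E] {Q Q' : ℝ → E → Measure E}
    (hQ : ∀ t, 0 ≤ t → Q t = Q' t) (n : ℕ) {s t : ℝ} (hs : 0 ≤ s) (hst : s ≤ t) (x : E) :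
    Piter Q n s t x = Piter Q' n s t x := by
  have hexp {s r : ℝ} (hs : 0 ≤ s) (hsr : s ≤ r) (x : E) :
      ENNReal.ofReal (Real.exp (-∫ τ in s..r, qIntensity Q τ x)) =
        ENNReal.ofReal (Real.exp (-∫ τ in s..r, qIntensity Q' τ x)) := by
    congr 3
    refine intervalIntegral.integral_congr fun τ hτ => ?_
    rw [uIcc_of_le hsr] at hτ
    simp only [qIntensity, hQ τ (hs.trans hτ.1)]
  induction n generalizing s x with
  | zero => simp only [Piter, hexp hs hst]
  | succ n ih =>
    simp only [Piter]
    rw [withDensity_congr_ae (g := fun r =>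
      ENNReal.ofReal (Real.exp (-∫ τ in s..r, qIntensity Q' τ x)))
      (ae_restrict_of_forall_mem measurableSet_Ioc fun r hr => hexp hs hr.1.le x)]
    refine Measure.bind_congr_right ((withDensity_absolutelyContinuous _ _).ae_le
      (ae_restrict_of_forall_mem measurableSet_Ioc fun r hr => ?_))
    have hr0 : 0 ≤ r := hs.trans hr.1.le
    simp only [hQ r hr0, ih hr0 hr.2]

theorem Pmin_congr [MeasurableSpace E] {Q Q' : ℝ → E → Measure E}
    (hQ : ∀ t, 0 ≤ t → Q t = Q' t) {s t : ℝ} (hs : 0 ≤ s) (hst : s ≤ t) (x : E) :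
    Pmin Q s t x = Pmin Q' s t x := by
  simp only [Pmin, Piter_congr hQ _ hs hst]

/-- Freezing a transition function at time zero for negative times. -/
theorem IsTransitionFunction.isContinuousRate_max [MeasurableSpace E] [TopologicalSpace E]
    {Q : ℝ → E → Measure E} {V : E → ℝ} {c : ℝ → ℝ} (hQ : IsTransitionFunction Q)
    (hH : StandingHypotheses Q V c) : IsContinuousRate fun t => Q (max t 0) where
  finite t x := hQ.1 _ x (le_max_right t 0)
  measurable := by
    refine Measure.measurable_of_measurable_coe _ fun A hA => ?_
    exact (hQ.2.2.1 A hA).comp (f := fun p : ℝ × E => (max p.1 0, p.2)) (by fun_prop)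
  continuous x := by
    have h1 := hH.weak_cont (fun _ => 1) continuous_const
      ⟨1, fun y => by simpa using hH.V_nonneg y⟩
    have h2 := h1.comp_continuous (f := fun t : ℝ => (max t 0, x)) (by fun_prop)
      fun t => le_max_right t 0
    simpa [qIntensity, Measure.real, Function.comp_def] using h2

/-- Forward Kolmogorov equation.  Under the standing hypotheses (H), for
bounded measurable `F`, `s ≥ 0` and `x`: the bound
`∫_E q(r,y) P(s,x;r,dy) ≤ a(T) V(x) e^{∫_s^r c}` holds for `s ≤ r ≤ T`, the forward
integral identity `U(s,t)F(x) = F(x) + ∫_s^t ∫_E L(r)F(y) P(s,x;r,dy) dr` holds, and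
`t ↦ U(s,t)F(x)` has derivative `U(s,t)L(t)F(x)` for almost all `t ≥ s`. -/
theorem forward_kolmogorov_equation [MeasurableSpace E] [TopologicalSpace E]
    [BorelSpace E] [PolishSpace E] [LocallyCompactSpace E]
    (Q : ℝ → E → Measure E) (V : E → ℝ) (c : ℝ → ℝ)
    (hQ : IsTransitionFunction Q) (hH : StandingHypotheses Q V c)
    (F : E → ℝ) (hFm : Measurable F) (hFb : ∃ M : ℝ, ∀ x, |F x| ≤ M)
    (s : ℝ) (hs : 0 ≤ s) (x : E) :
    (∀ T > (0 : ℝ), ∀ a > (0 : ℝ),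
      (∀ u ∈ Icc (0 : ℝ) T, ∀ y, qIntensity Q u y ≤ a * V y) →
      ∀ r : ℝ, s ≤ r → r ≤ T →
        ∫⁻ y, ENNReal.ofReal (qIntensity Q r y) ∂(Pmin Q s r x)
          ≤ ENNReal.ofReal (a * V x * Real.exp (∫ τ in s..r, c τ))) ∧
    (∀ t : ℝ, s ≤ t →
      Umin Q s t F x = F x + ∫ r in s..t, ∫ y, Lgen Q r F y ∂(Pmin Q s r x)) ∧
    (∀ᵐ t ∂(volume.restrict (Ici s)),
      HasDerivAt (fun u => Umin Q s u F x) (∫ y, Lgen Q t F y ∂(Pmin Q s t x)) t) := by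
  set Q' : ℝ → E → Measure E := fun t => Q (max t 0) with hQ'
  have hQQ (t : ℝ) (ht : 0 ≤ t) : Q t = Q' t := by simp [hQ', ht]
  have h : IsContinuousRate Q' := hQ.isContinuousRate_max hH
  have hcc : Continuous fun t => c (max t 0) := hH.c_cont.comp (by fun_prop)
  have hV (r : ℝ) (hr : s ≤ r) : ∫⁻ y, ENNReal.ofReal (V y) ∂(Pmin Q s r x) ≤
      ENNReal.ofReal (V x * Real.exp (∫ τ in s..r, c τ)) := by
    rw [Pmin_congr hQQ hs hr]
    convert h.lintegral_Pmin_le hH.V_cont.measurable hH.V_nonneg hcc (fun t => hH.c_nonneg _)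
      (fun t x => hH.lyapunov (max t 0) (le_max_right _ _) x) hr x using 4
    refine intervalIntegral.integral_congr fun τ hτ => ?_
    rw [uIcc_of_le hr] at hτ
    simp [hs.trans hτ.1]
  have hrate : ∀ T > (0 : ℝ), ∀ a > (0 : ℝ),
      (∀ u ∈ Icc (0 : ℝ) T, ∀ y, qIntensity Q u y ≤ a * V y) →
      ∀ r : ℝ, s ≤ r → r ≤ T →
        ∫⁻ y, ENNReal.ofReal (qIntensity Q r y) ∂(Pmin Q s r x)
          ≤ ENNReal.ofReal (a * V x * Real.exp (∫ τ in s..r, c τ)) := by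
    intro T _ a ha hq r hsr hrT
    calc _ ≤ ∫⁻ y, ENNReal.ofReal a * ENNReal.ofReal (V y) ∂(Pmin Q s r x) := by
          refine lintegral_mono fun y => ?_
          rw [← ENNReal.ofReal_mul ha.le]
          exact ENNReal.ofReal_le_ofReal (hq r ⟨hs.trans hsr, hrT⟩ y)
      _ = ENNReal.ofReal a * ∫⁻ y, ENNReal.ofReal (V y) ∂(Pmin Q s r x) :=
          lintegral_const_mul' _ _ ENNReal.ofReal_ne_top
      _ ≤ _ := by
          rw [mul_assoc, ENNReal.ofReal_mul ha.le]
          gcongr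
          exact hV r hsr
  obtain ⟨M, hM⟩ := hFb
  set J : ℝ → ℝ := fun r => ∫ y, Lgen Q r F y ∂(Pmin Q s r x) with hJ
  have hJ' {t : ℝ} : ∀ r ∈ Icc s t,
      J r = ∫ y, Lgen Q' r F y ∂(Pmin Q' s r x) := fun r hr => by
    simp only [hJ, Pmin_congr hQQ hs hr.1, Lgen, hQQ r (hs.trans hr.1)]
  have hforward (t : ℝ) (hst : s ≤ t) :
      IntegrableOn J (Ioc s t) ∧ Umin Q s t F x = F x + ∫ r in s..t, J r := by
    obtain ⟨a, ha, hq⟩ := hH.q_bound (t + 1) (by linarith)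
    have hVexp (r : ℝ) (hr : r ∈ Ioc s t) :
        ∫⁻ y, Q' r y univ ∂(Pmin Q' s r x) ≤
          ENNReal.ofReal (a * V x * Real.exp (∫ τ in s..t, c τ)) := by
      have hr0 : 0 ≤ r := hs.trans hr.1.le
      have h1 := hrate (t + 1) (by linarith) a ha hq r hr.1.le (by linarith [hr.2])
      rw [Pmin_congr hQQ hs hr.1.le] at h1
      have hqq (y : E) : qIntensity Q r y = qIntensity Q' r y := by
        simp only [qIntensity, hQQ r hr0]
      simp_rw [hqq, h.ofReal_qIntensity] at h1
      refine h1.trans (ENNReal.ofReal_le_ofReal ?_)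
      have hc (a b : ℝ) : IntervalIntegrable c volume a b := hH.c_cont.intervalIntegrable a b
      have hcr : 0 ≤ ∫ τ in r..t, c τ :=
        intervalIntegral.integral_nonneg hr.2 fun τ _ => hH.c_nonneg τ
      have hadd := intervalIntegral.integral_add_adjacent_intervals (hc s r) (hc r t)
      refine mul_le_mul_of_nonneg_left (Real.exp_le_exp.2 ?_) (mul_nonneg ha.le (hH.V_nonneg x))
      linarith
    obtain ⟨hi, hU⟩ := h.Umin_eq hFm hM hst x ENNReal.ofReal_ne_top hVexp
    refine ⟨(integrableOn_congr_fun (fun r hr => hJ' r (Ioc_subset_Icc_self hr))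
      measurableSet_Ioc).2 hi, ?_⟩
    rw [Umin, Pmin_congr hQQ hs hst, ← Umin, hU]
    congr 1
    refine intervalIntegral.integral_congr fun r hr => ?_
    rw [uIcc_of_le hst] at hr
    exact (hJ' r hr).symm
  refine ⟨hrate, fun t hst => (hforward t hst).2, ?_⟩
  have hderiv : ∀ᵐ t, ∀ n : ℕ, t ∈ uIcc s (s + n) → ∀ b ∈ uIcc s (s + n),
      HasDerivAt (fun u => ∫ r in b..u, J r) (J t) t := by
    refine ae_all_iff.2 fun n => IntervalIntegrable.ae_hasDerivAt_integral ?_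
    have hn : s ≤ s + n := by simp
    exact (intervalIntegrable_iff_integrableOn_Ioc_of_le hn).2 (hforward _ hn).1
  rw [← restrict_Ioi_eq_restrict_Ici, ae_restrict_iff' measurableSet_Ioi]
  filter_upwards [hderiv] with t ht hst
  obtain ⟨n, hn⟩ := exists_nat_ge (t - s)
  have hst' : s < t := hst
  have hd := (ht n (by rw [uIcc_of_le (by simp)]; exact ⟨hst'.le, by linarith⟩) s
    left_mem_uIcc).const_add (F x)
  refine hd.congr_of_eventuallyEq ?_
  filter_upwards [Ioi_mem_nhds hst'] with u hu
  exact (hforward u (le_of_lt hu)).2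
end

section
/- Let d ≥ 1, Λ_B ⊆ Λ_A ⊆ ℝᵈ compact, N_B ∈ ℕ, and 0 < δ_A < δ_B. Let η be a finite subset of Λ_B with |η| ≤ N_B such that |x − y| ≥ δ_B for all distinct x, y ∈ η. Let a⁺ : ℝᵈ × ℝᵈ → [0,∞) be measurable, a* : ℝᵈ → [0,∞) integrable with a⁺(x,y) ≤ a*(y) for all x ∈ Λ_B and y ∈ ℝᵈ, and c > 0 with a⁺(x,y) ≤ c for all x ∈ Λ_B and all y with dist(y,Λ_B) ≤ δ_B. Define A := { ζ ⊆ Λ_A finite : |ζ| ≤ N_B + 1 and |w − z| ≥ δ_A for all distinct w, z ∈ ζ }. Then for every x ∈ Λ_B: ∫_{ℝᵈ} 1[η ∪ {y} ∉ A] · a⁺(x,y) dy ≤ ∫_{ℝᵈ∖Λ_A} a*(y) dy + N_B · c · vol(B(0,δ_A)), where vol(B(0,δ_A)) is the Lebesgue volume of the ball of radius δ_A in ℝᵈ. -/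
open MeasureTheory Set

/-- If adding a point `y` to an `r`-separated finite set `η` destroys `r`-separation, then `y` lies
within distance `r` of some point of `η`. -/
lemma exists_dist_lt_of_insert_not_separated {X : Type*} [PseudoMetricSpace X] [DecidableEq X]
    {η : Finset X} {r : ℝ} (hsep : ∀ w ∈ η, ∀ z ∈ η, w ≠ z → r ≤ dist w z) {y : X}
    (h : ¬∀ w ∈ insert y η, ∀ z ∈ insert y η, w ≠ z → r ≤ dist w z) :
    ∃ z ∈ η, dist y z < r := by
  by_contra! hfar
  refine h fun w hw z hz hwz => ?_
  rw [Finset.mem_insert] at hw hz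
  rcases hw with rfl | hw <;> rcases hz with rfl | hz
  · exact absurd rfl hwz
  · exact hfar z hz
  · rw [dist_comm]
    exact hfar w hw
  · exact hsep w hw z hz hwz

/-- Localization estimate (condition (A)) for the birth part of the BDLP
model: if `η ⊆ Λ_B` has at most `N_B` points pairwise `δ_B`-separated, and `A` denotes
the set of configurations in `Λ_A` with at most `N_B + 1` points pairwise
`δ_A`-separated (`δ_A < δ_B`), then
`∫ 1[η ∪ {y} ∉ A] a⁺(x,y) dy ≤ ∫_{Λ_Aᶜ} a*(y) dy + N_B c vol(B(0,δ_A))`. -/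
theorem bdlp_localization_estimate (d : ℕ) (hd : 1 ≤ d)
    [DecidableEq (EuclideanSpace ℝ (Fin d))]
    (ΛB ΛA : Set (EuclideanSpace ℝ (Fin d)))
    (hΛB : IsCompact ΛB) (hΛA : IsCompact ΛA) (hBA : ΛB ⊆ ΛA)
    (NB : ℕ) (δA δB : ℝ) (hδA : 0 < δA) (hδAB : δA < δB)
    (η : Finset (EuclideanSpace ℝ (Fin d)))
    (hη : ↑η ⊆ ΛB) (hcard : η.card ≤ NB)
    (hsep : ∀ x ∈ η, ∀ y ∈ η, x ≠ y → δB ≤ dist x y)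
    (aplus : EuclideanSpace ℝ (Fin d) → EuclideanSpace ℝ (Fin d) → ℝ)
    (haplusmeas : Measurable fun p :
      EuclideanSpace ℝ (Fin d) × EuclideanSpace ℝ (Fin d) => aplus p.1 p.2)
    (haplus0 : ∀ x y, 0 ≤ aplus x y)
    (astar : EuclideanSpace ℝ (Fin d) → ℝ)
    (hastar0 : ∀ y, 0 ≤ astar y) (hastarint : Integrable astar)
    (hdom : ∀ x ∈ ΛB, ∀ y, aplus x y ≤ astar y)
    (c : ℝ) (hc : 0 < c)
    (hcbound : ∀ x ∈ ΛB, ∀ y, Metric.infDist y ΛB ≤ δB → aplus x y ≤ c)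
    (x : EuclideanSpace ℝ (Fin d)) (hx : x ∈ ΛB) :
    ∫ y, Set.indicator
        {y : EuclideanSpace ℝ (Fin d) |
          ¬(↑(insert y η) ⊆ ΛA ∧ (insert y η).card ≤ NB + 1 ∧
            ∀ w ∈ insert y η, ∀ z ∈ insert y η, w ≠ z → δA ≤ dist w z)}
        (fun y => aplus x y) y
      ≤ (∫ y in ΛAᶜ, astar y)
        + (NB : ℝ) * c *
          (volume (Metric.ball (0 : EuclideanSpace ℝ (Fin d)) δA)).toReal := by
  have hballint : ∀ z ∈ η, Integrable ((Metric.ball z δA).indicator fun _ => c) := fun z _ =>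
    (integrable_indicator_iff measurableSet_ball).2
      (integrableOn_const measure_ball_lt_top.ne)
  have houtint : Integrable (ΛAᶜ.indicator astar) :=
    hastarint.indicator hΛA.measurableSet.compl
  have hsumint : Integrable fun y => ∑ z ∈ η, (Metric.ball z δA).indicator (fun _ => c) y :=
    integrable_finsetSum η hballint
  have hout0 : ∀ y, 0 ≤ ΛAᶜ.indicator astar y := fun y =>
    indicator_nonneg (fun y _ => hastar0 y) y
  have hball0 : ∀ y, ∀ z ∈ η, 0 ≤ (Metric.ball z δA).indicator (fun _ => c) y := fun y z _ =>
    indicator_nonneg (fun _ _ => hc.le) y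
  have hbound0 : ∀ y, 0 ≤ ΛAᶜ.indicator astar y
      + ∑ z ∈ η, (Metric.ball z δA).indicator (fun _ => c) y := fun y =>
    add_nonneg (hout0 y) (Finset.sum_nonneg (hball0 y))
  calc
    _ ≤ ∫ y, (ΛAᶜ.indicator astar y
          + ∑ z ∈ η, (Metric.ball z δA).indicator (fun _ => c) y) := by
      refine integral_mono_of_nonneg
        (.of_forall fun y => indicator_nonneg (fun y _ => haplus0 x y) y)
        (houtint.add hsumint) (.of_forall fun y => ?_)
      refine indicator_apply_le' (fun hy => ?_) (fun _ => hbound0 y)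
      by_cases hyA : y ∈ ΛA
      · have hnotsep : ¬∀ w ∈ insert y η, ∀ z ∈ insert y η, w ≠ z → δA ≤ dist w z := by
          refine fun h => hy ⟨?_, (Finset.card_insert_le y η).trans (by omega), h⟩
          rw [Finset.coe_insert]
          exact insert_subset hyA (hη.trans hBA)
        obtain ⟨z, hz, hyz⟩ := exists_dist_lt_of_insert_not_separated
          (fun w hw z hz hwz => hδAB.le.trans (hsep w hw z hz hwz)) hnotsep
        calc
          aplus x y ≤ c := hcbound x hx y
            ((Metric.infDist_le_dist_of_mem (hη hz)).trans (hyz.trans hδAB).le)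
          _ = (Metric.ball z δA).indicator (fun _ => c) y :=
            (indicator_of_mem (Metric.mem_ball.2 hyz) fun _ => c).symm
          _ ≤ ∑ z ∈ η, (Metric.ball z δA).indicator (fun _ => c) y :=
            Finset.single_le_sum (hball0 y) hz
          _ ≤ _ := le_add_of_nonneg_left (hout0 y)
      · calc
          aplus x y ≤ astar y := hdom x hx y
          _ = ΛAᶜ.indicator astar y := (indicator_of_mem (mem_compl hyA) _).symm
          _ ≤ _ := le_add_of_nonneg_right (Finset.sum_nonneg (hball0 y))
    _ = (∫ y in ΛAᶜ, astar y) + (η.card : ℝ) * c *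
          (volume (Metric.ball (0 : EuclideanSpace ℝ (Fin d)) δA)).toReal := by
      rw [integral_add houtint hsumint, integral_indicator hΛA.measurableSet.compl,
        integral_finsetSum η hballint]
      simp only [integral_indicator_const _ measurableSet_ball, Measure.real,
        Measure.addHaar_ball_center, Finset.sum_const, nsmul_eq_mul, smul_eq_mul]
      ring
    _ ≤ _ := by gcongr
end

section
/- Let d ≥ 1, η a nonempty finite subset of ℝᵈ, a⁻, b⁺ : ℝᵈ → [0,∞) bounded with sup-norms ‖a⁻‖_∞, ‖b⁺‖_∞, and set E⁺(η) := Σ_{x∈η} Σ_{y∈η∖{x}} b⁺(x−y) and E⁻(η) := Σ_{x∈η} Σ_{y∈η∖{x}} a⁻(x−y). Assume the stability condition E⁺(η) ≤ b|η| + E⁻(η) for a constant b ≥ 0. Then for every n ≥ 1 and every λ ≥ 0: λ Σ_{l=0}^{n−1} C(n,l) |η|^{l+1} + Σ_{l=0}^{n−1} C(n,l) |η|^l ( E⁺(η) + (−1)^{n−l} E⁻(η) ) ≤ 2ⁿ (λ + ‖b⁺‖_∞ + ‖a⁻‖_∞) n |η|ⁿ + b n |η|ⁿ, where C(n,l) are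 binomial coefficients. (Dieckmann–Law model: this gives L(t)|·|ⁿ(η) ≤ c_n(t)|η|ⁿ and hence propagation of n-th moments.) -/
open Finset

theorem sum_range_choose_le_two_pow (n : ℕ) :
    ∑ l ∈ Finset.range n, (n.choose l : ℝ) ≤ 2 ^ n := by
  have h : ∑ l ∈ Finset.range (n + 1), (n.choose l : ℝ) = 2 ^ n := by
    exact_mod_cast Nat.sum_range_choose n
  rw [Finset.sum_range_succ] at h
  have : (0 : ℝ) ≤ n.choose n := Nat.cast_nonneg _
  linarith

/-- A sum over ordered pairs of distinct points is at most the squared cardinality times a bound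
for the kernel. -/
theorem sum_sum_erase_le {G : Type*} [Sub G] [DecidableEq G] (η : Finset G) (f : G → ℝ) {C : ℝ}
    (hC : 0 ≤ C) (hf : ∀ x, f x ≤ C) :
    ∑ x ∈ η, ∑ y ∈ η.erase x, f (x - y) ≤ C * (η.card : ℝ) ^ 2 := by
  have inner (x : G) : ∑ y ∈ η.erase x, f (x - y) ≤ η.card * C := by
    calc ∑ y ∈ η.erase x, f (x - y) ≤ (η.erase x).card * C := by
          simpa using Finset.sum_le_card_nsmul (η.erase x) _ C fun y _ => hf (x - y)
      _ ≤ η.card * C := by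
          gcongr
          exact Finset.erase_subset x η
  calc ∑ x ∈ η, ∑ y ∈ η.erase x, f (x - y) ≤ η.card * (η.card * C) := by
        simpa using Finset.sum_le_card_nsmul η _ _ fun x _ => inner x
    _ = C * (η.card : ℝ) ^ 2 := by ring

/-- The moment estimate for real numbers `N`, `P`, `M` in place of `|η|`, `E⁺(η)`, `E⁻(η)`. -/
theorem moment_estimate_of_bounds {N P M A B b lam : ℝ} (hN : 1 ≤ N) (hM : 0 ≤ M)
    (hA : 0 ≤ A) (hB : 0 ≤ B) (hMA : M ≤ A * N ^ 2) (hPB : P ≤ B * N ^ 2)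
    (hstab : P ≤ b * N + M) (hlam : 0 ≤ lam) {n : ℕ} (hn : 1 ≤ n) :
    lam * (∑ l ∈ Finset.range n, (n.choose l : ℝ) * N ^ (l + 1))
        + (∑ l ∈ Finset.range n, (n.choose l : ℝ) * N ^ l * (P + (-1 : ℝ) ^ (n - l) * M))
      ≤ 2 ^ n * (lam + B + A) * n * N ^ n + b * n * N ^ n := by
  have hN0 : 0 ≤ N := zero_le_one.trans hN
  have birth : ∑ l ∈ Finset.range n, (n.choose l : ℝ) * N ^ (l + 1) ≤ 2 ^ n * N ^ n := by
    calc ∑ l ∈ Finset.range n, (n.choose l : ℝ) * N ^ (l + 1)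
        ≤ ∑ l ∈ Finset.range n, (n.choose l : ℝ) * N ^ n := by
          gcongr with l hl
          exact Finset.mem_range.mp hl
      _ ≤ 2 ^ n * N ^ n := by
          rw [← Finset.sum_mul]
          gcongr
          exact sum_range_choose_le_two_pow n
  have interaction :
      ∑ l ∈ Finset.range n, (n.choose l : ℝ) * N ^ l * (P + (-1 : ℝ) ^ (n - l) * M)
        ≤ 2 ^ n * ((B + A) * N ^ n) + b * n * N ^ n := by
    obtain ⟨m, rfl⟩ := Nat.exists_eq_add_of_le' hn
    have low : ∑ l ∈ Finset.range m,
        ((m + 1).choose l : ℝ) * N ^ l * (P + (-1 : ℝ) ^ (m + 1 - l) * M)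
          ≤ 2 ^ (m + 1) * ((B + A) * N ^ (m + 1)) := by
      calc _ ≤ ∑ l ∈ Finset.range m, ((m + 1).choose l : ℝ) * ((B + A) * N ^ (m + 1)) := by
            refine Finset.sum_le_sum fun l hl => ?_
            have hl' : l + 2 ≤ m + 1 := by
              have := Finset.mem_range.mp hl
              omega
            have hsign : (-1 : ℝ) ^ (m + 1 - l) * M ≤ M := by
              rcases neg_one_pow_eq_or ℝ (m + 1 - l) with h | h <;> rw [h] <;> linarith
            rw [mul_assoc]
            refine mul_le_mul_of_nonneg_left ?_ (Nat.cast_nonneg _)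
            calc N ^ l * (P + (-1 : ℝ) ^ (m + 1 - l) * M)
                ≤ N ^ l * ((B + A) * N ^ 2) := by gcongr; linarith
              _ = (B + A) * N ^ (l + 2) := by ring
              _ ≤ (B + A) * N ^ (m + 1) := by gcongr
        _ ≤ 2 ^ (m + 1) * ((B + A) * N ^ (m + 1)) := by
            rw [← Finset.sum_mul]
            gcongr
            have h := sum_range_choose_le_two_pow (m + 1)
            rw [Finset.sum_range_succ] at h
            have : (0 : ℝ) ≤ (m + 1).choose m := Nat.cast_nonneg _
            linarith
    have top : ((m + 1).choose m : ℝ) * N ^ m * (P + (-1 : ℝ) ^ (m + 1 - m) * M)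
        ≤ b * (m + 1 : ℕ) * N ^ (m + 1) := by
      rw [Nat.choose_succ_self_right, Nat.add_sub_cancel_left, pow_one]
      calc ((m + 1 : ℕ) : ℝ) * N ^ m * (P + -1 * M)
          ≤ ((m + 1 : ℕ) : ℝ) * N ^ m * (b * N) := by gcongr; linarith
        _ = b * (m + 1 : ℕ) * N ^ (m + 1) := by ring
    rw [Finset.sum_range_succ]
    exact add_le_add low top
  have hn' : (1 : ℝ) ≤ n := by exact_mod_cast hn
  calc _ ≤ lam * (2 ^ n * N ^ n) + (2 ^ n * ((B + A) * N ^ n) + b * n * N ^ n) := by gcongr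
    _ = 2 ^ n * (lam + B + A) * 1 * N ^ n + b * n * N ^ n := by ring
    _ ≤ 2 ^ n * (lam + B + A) * n * N ^ n + b * n * N ^ n := by gcongr

/-- Dieckmann–Law model, propagation of `n`-th moments: under the
stability condition `E⁺(η) ≤ b|η| + E⁻(η)`, for every `n ≥ 1` and `λ ≥ 0`:
`λ Σ_{l<n} C(n,l)|η|^{l+1} + Σ_{l<n} C(n,l)|η|^l (E⁺(η) + (−1)^{n−l} E⁻(η))
  ≤ 2ⁿ(λ + ‖b⁺‖_∞ + ‖a⁻‖_∞) n |η|ⁿ + b n |η|ⁿ`. -/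
theorem dieckmann_law_moment_estimate (d : ℕ) (hd : 1 ≤ d)
    (η : Finset (Fin d → ℝ)) (hne : η.Nonempty)
    (aminus bplus : (Fin d → ℝ) → ℝ) (Ca Cb : ℝ)
    (ha0 : ∀ x, 0 ≤ aminus x) (haB : ∀ x, aminus x ≤ Ca)
    (hb0 : ∀ x, 0 ≤ bplus x) (hbB : ∀ x, bplus x ≤ Cb)
    (b : ℝ) (hb : 0 ≤ b)
    (hstab : (∑ x ∈ η, ∑ y ∈ η.erase x, bplus (x - y))
      ≤ b * (η.card : ℝ) + ∑ x ∈ η, ∑ y ∈ η.erase x, aminus (x - y))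
    (n : ℕ) (hn : 1 ≤ n) (lam : ℝ) (hlam : 0 ≤ lam) :
    lam * (∑ l ∈ Finset.range n, (n.choose l : ℝ) * (η.card : ℝ) ^ (l + 1))
        + (∑ l ∈ Finset.range n, (n.choose l : ℝ) * (η.card : ℝ) ^ l *
            ((∑ x ∈ η, ∑ y ∈ η.erase x, bplus (x - y))
              + (-1 : ℝ) ^ (n - l) * (∑ x ∈ η, ∑ y ∈ η.erase x, aminus (x - y))))
      ≤ 2 ^ n * (lam + Cb + Ca) * (n : ℝ) * (η.card : ℝ) ^ n
        + b * (n : ℝ) * (η.card : ℝ) ^ n := by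
  have hCa : 0 ≤ Ca := (ha0 0).trans (haB 0)
  have hCb : 0 ≤ Cb := (hb0 0).trans (hbB 0)
  exact moment_estimate_of_bounds (by exact_mod_cast hne.card_pos)
    (Finset.sum_nonneg fun x _ => Finset.sum_nonneg fun y _ => ha0 (x - y)) hCa hCb
    (sum_sum_erase_le η aminus hCa haB) (sum_sum_erase_le η bplus hCb hbB) hstab hlam hn
end

section
/- Let d ≥ 1, η a finite subset of ℝᵈ, a⁻, b⁺ : ℝᵈ → [0,∞) bounded with sup-norms ‖a⁻‖_∞, ‖b⁺‖_∞, λ, m ≥ 0 reals, and set E⁺(η) := Σ_{x∈η} Σ_{y∈η∖{x}} b⁺(x−y) and E⁻(η) := Σ_{x∈η} Σ_{y∈η∖{x}} a⁻(x−y). Then: (1) if the stability condition E⁺(η) ≤ b|η| + E⁻(η) holds for a constant b ≥ 0, the Dieckmann–Law generator applied to V(η) = |η| + |η|², namely (λ|η| + E⁺(η))(2|η| + 2) − 2|η|(m|η| + E⁻(η)), is at most (2λ + 2‖b⁺‖_∞ + 2b)(|η| + |η|²) (Foster–Lyapunov condition (B)); and (2) the cumulative intensity satisfies (m + λ)|η|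 + E⁺(η) + E⁻(η) ≤ (‖a⁻‖_∞ + ‖b⁺‖_∞)|η|² + (m + λ)|η| (condition (D)). -/
open Finset

/-- A sum over ordered pairs of distinct points, with terms at most `C ≥ 0`, is at most
`C * s.card ^ 2`. -/
theorem sum_sum_erase_le_mul_card_sq {α : Type*} [DecidableEq α] (s : Finset α)
    (f : α → α → ℝ) {C : ℝ} (hC : 0 ≤ C) (hf : ∀ x y, f x y ≤ C) :
    ∑ x ∈ s, ∑ y ∈ s.erase x, f x y ≤ C * (s.card : ℝ) ^ 2 := by
  have inner_le (x : α) : ∑ y ∈ s.erase x, f x y ≤ s.card * C :=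
    calc ∑ y ∈ s.erase x, f x y ≤ (s.erase x).card * C := by
          simpa using sum_le_card_nsmul (s.erase x) (f x) C fun y _ => hf x y
      _ ≤ s.card * C := by
          gcongr
          exact erase_subset x s
  calc ∑ x ∈ s, ∑ y ∈ s.erase x, f x y ≤ s.card * (s.card * C) := by
        simpa using sum_le_card_nsmul s _ _ fun x _ => inner_le x
    _ = C * (s.card : ℝ) ^ 2 := by ring

/-- Dieckmann–Law model: (1) under the stability condition
`E⁺(η) ≤ b|η| + E⁻(η)` the generator applied to `V(η) = |η| + |η|²`, namely
`(λ|η| + E⁺(η))(2|η| + 2) − 2|η|(m|η| + E⁻(η))`, is bounded by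
`(2λ + 2‖b⁺‖_∞ + 2b)(|η| + |η|²)` (condition (B)); and (2) the cumulative intensity
satisfies `(m + λ)|η| + E⁺(η) + E⁻(η) ≤ (‖a⁻‖_∞ + ‖b⁺‖_∞)|η|² + (m + λ)|η|`
(condition (D)). -/
theorem dieckmann_law_lyapunov_and_intensity (d : ℕ) (hd : 1 ≤ d)
    (η : Finset (Fin d → ℝ))
    (aminus bplus : (Fin d → ℝ) → ℝ) (Ca Cb : ℝ)
    (ha0 : ∀ x, 0 ≤ aminus x) (haB : ∀ x, aminus x ≤ Ca)
    (hb0 : ∀ x, 0 ≤ bplus x) (hbB : ∀ x, bplus x ≤ Cb)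
    (lam m : ℝ) (hlam : 0 ≤ lam) (hm : 0 ≤ m)
    (b : ℝ) (hb : 0 ≤ b) :
    (((∑ x ∈ η, ∑ y ∈ η.erase x, bplus (x - y))
        ≤ b * (η.card : ℝ) + ∑ x ∈ η, ∑ y ∈ η.erase x, aminus (x - y)) →
      (lam * (η.card : ℝ) + (∑ x ∈ η, ∑ y ∈ η.erase x, bplus (x - y)))
            * (2 * (η.card : ℝ) + 2)
          - 2 * (η.card : ℝ)
            * (m * (η.card : ℝ) + (∑ x ∈ η, ∑ y ∈ η.erase x, aminus (x - y)))
        ≤ (2 * lam + 2 * Cb + 2 * b) * ((η.card : ℝ) + (η.card : ℝ) ^ 2)) ∧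
    ((m + lam) * (η.card : ℝ)
        + (∑ x ∈ η, ∑ y ∈ η.erase x, bplus (x - y))
        + (∑ x ∈ η, ∑ y ∈ η.erase x, aminus (x - y))
      ≤ (Ca + Cb) * (η.card : ℝ) ^ 2 + (m + lam) * (η.card : ℝ)) := by
  have hCa : 0 ≤ Ca := (ha0 0).trans (haB 0)
  have hCb : 0 ≤ Cb := (hb0 0).trans (hbB 0)
  have hA := sum_sum_erase_le_mul_card_sq η (fun x y => aminus (x - y)) hCa fun _ _ => haB _
  have hB := sum_sum_erase_le_mul_card_sq η (fun x y => bplus (x - y)) hCb fun _ _ => hbB _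
  have hn : (0 : ℝ) ≤ η.card := Nat.cast_nonneg _
  refine ⟨fun hstab => ?_, by linarith⟩
  have hstab' := mul_le_mul_of_nonneg_left hstab hn
  have hbn := mul_nonneg hb hn
  have hCbn := mul_nonneg hCb hn
  have hmn := mul_nonneg hm (sq_nonneg (η.card : ℝ))
  linarith
end
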